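/- (Relative exchange property.) Let w ∈ W̃ and let s̃ ∈ S̃ satisfy ℓ(s̃ w) < ℓ(w). Suppose w = w₁ w₂ ⋯ w_r is a decomposition with w_i ∈ S̃ for all i and ℓ(w) = ℓ(w₁) + ℓ(w₂) + ⋯ + ℓ(w_r). Then there exists an index 1 ≤ i ≤ r such that s̃ w₁ ⋯ w_{i−1} = w₁ ⋯ w_i. -/

import Mathlib

/-!
Relative Coxeter groups: common definitions.

`(W, S)` is a Coxeter system (Mathlib's `CoxeterSystem M W`), `ℓ = cs.length`.
For `w : W`, `invSet cs w` is the set `T(w)` of left inversions of `w`, and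
`descSet cs w = T(w) ∩ S` is `D(w)`.  For a subset `Sg ⊆ S` (playing the role of `Σ`),
`par Sg` is the standard parabolic subgroup `W_Σ`, `parRefl Sg` its set of
reflections `T_Σ`, `minRight cs Sg = W^Σ`, `minLeft cs Sg = ^ΣW`,
`relN cs Sg Sg' = N(Σ, Σ')`, `IsLongest cs Sg w` says `w` is a longest element of `W_Σ`,
`longest cs Sg` is the longest element `w₀^Σ`, `relW cs Sg = W̃`,
`complSet cs Sg = Σ^∁`, `tilde cs Sg s = s̃ = w₀^{Σ∪{s}} w₀^Σ`, `relS cs Sg = S̃`,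
`relLength cs Sg = ℓ̃ : W → ℕ∞`, and `GoodSubset cs Sg` records the standing
hypotheses (1) and (2) on `Σ`.
-/

namespace RelativeCoxeter

variable {B W : Type*} [Group W] {M : CoxeterMatrix B}

/-- The set `S` of simple reflections of the Coxeter system. -/
def simpleSet (cs : CoxeterSystem M W) : Set W := Set.range cs.simple

/-- `T(w)`: the set of left inversions of `w`, i.e. reflections `t` with `ℓ(tw) < ℓ(w)`. -/
def invSet (cs : CoxeterSystem M W) (w : W) : Set W :=
  {t | cs.IsReflection t ∧ cs.length (t * w) < cs.length w}

/-- `D(w) = T(w) ∩ S`. -/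
def descSet (cs : CoxeterSystem M W) (w : W) : Set W :=
  invSet cs w ∩ simpleSet cs

/-- The standard parabolic subgroup `W_Σ` generated by `Σ`. -/
def par (Sg : Set W) : Subgroup W := Subgroup.closure Sg

/-- `T_Σ`: the set of reflections of the Coxeter system `(W_Σ, Σ)`. -/
def parRefl (Sg : Set W) : Set W :=
  {t | ∃ u ∈ par Sg, ∃ s ∈ Sg, t = u * s * u⁻¹}

/-- `W^Σ = {w : T(w⁻¹) ∩ T_Σ = ∅}`, minimal-length representatives of `W/W_Σ`. -/
def minRight (cs : CoxeterSystem M W) (Sg : Set W) : Set W :=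
  {w | invSet cs w⁻¹ ∩ parRefl Sg = ∅}

/-- `^ΣW = {w : T(w) ∩ T_Σ = ∅}`, minimal-length representatives of `W_Σ\W`. -/
def minLeft (cs : CoxeterSystem M W) (Sg : Set W) : Set W :=
  {w | invSet cs w ∩ parRefl Sg = ∅}

/-- `N(Σ, Σ') = {y ∈ W^Σ ∩ ^{Σ'}W : y W_Σ y⁻¹ = W_{Σ'}}`. -/
def relN (cs : CoxeterSystem M W) (Sg Sg' : Set W) : Set W :=
  {y | y ∈ minRight cs Sg ∧ y ∈ minLeft cs Sg' ∧
    (fun u => y * u * y⁻¹) '' (par Sg : Set W) = (par Sg' : Set W)}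

/-- `w` is a longest element of `W_Σ`. -/
def IsLongest (cs : CoxeterSystem M W) (Sg : Set W) (w : W) : Prop :=
  w ∈ par Sg ∧ ∀ u ∈ par Sg, cs.length u ≤ cs.length w

/-- The longest element `w₀^Σ` of `W_Σ` (defined when it exists; junk value `1` otherwise). -/
noncomputable def longest (cs : CoxeterSystem M W) (Sg : Set W) : W :=
  letI := Classical.propDecidable (∃ w, IsLongest cs Sg w)
  if h : ∃ w, IsLongest cs Sg w then h.choose else 1

/-- `W̃ = {w : w W_Σ w⁻¹ = W_Σ and T(w) ∩ T_Σ = ∅}`. -/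
def relW (cs : CoxeterSystem M W) (Sg : Set W) : Set W :=
  {w | (fun u => w * u * w⁻¹) '' (par Sg : Set W) = (par Sg : Set W) ∧
    invSet cs w ∩ parRefl Sg = ∅}

/-- `Σ^∁ = {s ∈ S ∖ Σ : W_{Σ∪{s}} is finite}`. -/
def complSet (cs : CoxeterSystem M W) (Sg : Set W) : Set W :=
  {s ∈ simpleSet cs \ Sg | ((par (Sg ∪ {s}) : Set W)).Finite}

/-- `s̃ = w₀^{Σ∪{s}} w₀^Σ`. -/
noncomputable def tilde (cs : CoxeterSystem M W) (Sg : Set W) (s : W) : W :=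
  longest cs (Sg ∪ {s}) * longest cs Sg

/-- `S̃ = {s̃ : s ∈ Σ^∁}`. -/
noncomputable def relS (cs : CoxeterSystem M W) (Sg : Set W) : Set W :=
  {w | ∃ s ∈ complSet cs Sg, w = tilde cs Sg s}

/-- `ℓ̃(w) ∈ ℕ ∪ {∞}`: the minimal `q` such that `w = w₁ ⋯ w_q` with all `w_i ∈ S̃`. -/
noncomputable def relLength (cs : CoxeterSystem M W) (Sg : Set W) (w : W) : ℕ∞ :=
  sInf {q : ℕ∞ | ∃ l : List W, (∀ x ∈ l, x ∈ relS cs Sg) ∧ l.prod = w ∧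
    (l.length : ℕ∞) = q}

/-- The standing hypotheses on `Σ`: `Σ ⊆ S`, `W_Σ` is finite, and for every `Σ'` with
`Σ ⊆ Σ' ⊆ S` and `W_{Σ'}` finite, the longest element `w₀^{Σ'}` normalises `W_Σ`. -/
def GoodSubset (cs : CoxeterSystem M W) (Sg : Set W) : Prop :=
  Sg ⊆ simpleSet cs ∧ ((par Sg : Set W)).Finite ∧
  ∀ Sg' : Set W, Sg ⊆ Sg' → Sg' ⊆ simpleSet cs → ((par Sg' : Set W)).Finite →
    ∀ w0 : W, IsLongest cs Sg' w0 →
      (fun u => w0 * u * w0⁻¹) '' (par Sg : Set W) = (par Sg : Set W)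

variable (cs : CoxeterSystem M W)

/-! ### The inversion cocycle -/

open Classical in
/-- The involution `(t, e) ↦ (s t s, e + [t = s])` attached to a simple reflection `s`. -/
noncomputable def signedConj (i : B) : Equiv.Perm (W × ZMod 2) :=
  Function.Involutive.toPerm
    (fun p => (cs.simple i * p.1 * cs.simple i, p.2 + if p.1 = cs.simple i then 1 else 0)) (by
      rintro ⟨t, e⟩
      have h : cs.simple i * t * cs.simple i = cs.simple i ↔ t = cs.simple i := by
        rw [mul_eq_right]
        constructor
        · intro h
          have := congrArg (cs.simple i * ·) h
          simpa using this
        · rintro rfl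
          simp
      ext
      · simp [mul_assoc]
      · simp only [h, add_assoc]
        split_ifs
        · rw [show (1 + 1 : ZMod 2) = 0 by decide, add_zero]
        · simp)

open Classical in
theorem signedConj_apply (i : B) (t : W) (e : ZMod 2) :
    signedConj cs i (t, e) =
      (cs.simple i * t * cs.simple i, e + if t = cs.simple i then 1 else 0) := rfl

open Classical in
theorem prod_signedConj_apply (ω : List B) (t : W) (e : ZMod 2) :
    (ω.map (signedConj cs)).reverse.prod (t, e) =
      ((cs.wordProd ω)⁻¹ * t * cs.wordProd ω, e + ((cs.leftInvSeq ω).count t : ℕ)) := by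
  induction ω generalizing t e with
  | nil => simp
  | cons i ω ih =>
    rw [List.map_cons, List.reverse_cons, List.prod_append, List.prod_singleton,
      Equiv.Perm.mul_apply, signedConj_apply, ih]
    have h : (List.map (⇑(MulAut.conj (cs.simple i))) (cs.leftInvSeq ω)).count t =
        (cs.leftInvSeq ω).count (cs.simple i * t * cs.simple i) := by
      rw [← List.count_map_of_injective _ _ (MulAut.conj (cs.simple i)).injective
        (cs.simple i * t * cs.simple i)]
      simp [mul_assoc]
    ext
    · simp [cs.wordProd_cons, mul_assoc]
    · simp only [CoxeterSystem.leftInvSeq, List.count_cons, h, beq_iff_eq]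
      by_cases hti : t = cs.simple i
      · subst hti
        simp
        ring
      · simp [hti, Ne.symm hti]

theorem prod_signedConj_alternatingWord (i j : B) (m : ℕ) :
    ((CoxeterSystem.alternatingWord j i (2 * m)).map (signedConj cs)).reverse.prod =
      (signedConj cs i * signedConj cs j) ^ m := by
  induction m with
  | zero => simp [CoxeterSystem.alternatingWord]
  | succ m ih =>
    rw [show 2 * (m + 1) = 2 * m + 1 + 1 by ring, CoxeterSystem.alternatingWord_succ,
      CoxeterSystem.alternatingWord_succ, pow_succ', ← ih]
    simp [mul_assoc]

open Classical in
theorem even_count_leftInvSeq_alternatingWord (i j : B) (t : W) :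
    Even ((cs.leftInvSeq (CoxeterSystem.alternatingWord i j (2 * M i j))).count t) := by
  set L := cs.leftInvSeq (CoxeterSystem.alternatingWord i j (2 * M i j)) with hL
  have hlen : L.length = 2 * M i j := by simp [hL]
  have hdrop : L.drop (M i j) = L.take (M i j) := by
    apply List.ext_getElem
    · simp [hlen]; omega
    · intro k h₁ h₂
      have hk : k < M i j := by simp [hlen] at h₂; omega
      rw [List.getElem_drop, List.getElem_take]
      simp only [hL]
      rw [cs.getElem_leftInvSeq_alternatingWord i j _ _ (by omega),
        cs.getElem_leftInvSeq_alternatingWord i j _ _ (by omega),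
        cs.prod_alternatingWord_eq_mul_pow, cs.prod_alternatingWord_eq_mul_pow]
      have e₁ : (2 * (M i j + k) + 1) / 2 = M i j + k := by omega
      have e₂ : (2 * k + 1) / 2 = k := by omega
      simp [e₁, e₂, pow_add, cs.simple_mul_simple_pow']
  rw [← List.take_append_drop (M i j) L, hdrop, List.count_append]
  exact ⟨_, rfl⟩

theorem isLiftable_signedConj : M.IsLiftable (signedConj cs) := by
  classical
  intro i j
  rw [← prod_signedConj_alternatingWord]
  ext1 ⟨t, e⟩
  rw [prod_signedConj_apply]
  have h := even_count_leftInvSeq_alternatingWord cs j i t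
  rw [M.symmetric j i] at h
  rw [(ZMod.natCast_eq_zero_iff_even).2 h, cs.prod_alternatingWord_eq_mul_pow]
  simp [M.symmetric i j]

/-- The action of `W` on pairs (element, sign) which records inversions. -/
noncomputable def signedConjHom : W →* Equiv.Perm (W × ZMod 2) :=
  cs.lift ⟨signedConj cs, isLiftable_signedConj cs⟩

/-- The inversion cocycle: for a reflection `t`, it is `1` if `t` is a left inversion of `w`
and `0` otherwise. -/
noncomputable def invCocycle (w t : W) : ZMod 2 := (signedConjHom cs w⁻¹ (t, 0)).2

open Classical in
theorem signedConjHom_inv_wordProd (ω : List B) (t : W) (e : ZMod 2) :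
    signedConjHom cs (cs.wordProd ω)⁻¹ (t, e) =
      ((cs.wordProd ω)⁻¹ * t * cs.wordProd ω, e + ((cs.leftInvSeq ω).count t : ℕ)) := by
  have h : ∀ i, signedConjHom cs (cs.simple i) = signedConj cs i := cs.lift_apply_simple _
  rw [← prod_signedConj_apply, ← cs.wordProd_reverse, CoxeterSystem.wordProd, map_list_prod,
    List.map_map, ← List.map_reverse]
  simp [Function.comp_def, h]

open Classical in
theorem invCocycle_wordProd (ω : List B) (t : W) :
    invCocycle cs (cs.wordProd ω) t = ((cs.leftInvSeq ω).count t : ℕ) := by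
  rw [invCocycle, signedConjHom_inv_wordProd, zero_add]

theorem signedConjHom_inv_apply (w t : W) (e : ZMod 2) :
    signedConjHom cs w⁻¹ (t, e) = (w⁻¹ * t * w, e + invCocycle cs w t) := by
  classical
  obtain ⟨ω, rfl⟩ := cs.wordProd_surjective w
  rw [signedConjHom_inv_wordProd, invCocycle_wordProd]

theorem invCocycle_mul (x y t : W) :
    invCocycle cs (x * y) t = invCocycle cs x t + invCocycle cs y (x⁻¹ * t * x) := by
  rw [invCocycle, mul_inv_rev, map_mul, Equiv.Perm.mul_apply, signedConjHom_inv_apply,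
    signedConjHom_inv_apply, zero_add]

@[simp]
theorem invCocycle_one (t : W) : invCocycle cs 1 t = 0 := by simp [invCocycle]

theorem invCocycle_inv (x t : W) : invCocycle cs x⁻¹ t = invCocycle cs x (x * t * x⁻¹) := by
  have h := invCocycle_mul cs x⁻¹ x t
  rw [inv_mul_cancel, invCocycle_one, inv_inv] at h
  exact CharTwo.add_eq_zero.1 h.symm

open Classical in
theorem invCocycle_simple (i : B) (t : W) :
    invCocycle cs (cs.simple i) t = if t = cs.simple i then 1 else 0 := by
  rw [← cs.wordProd_singleton, invCocycle_wordProd]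
  by_cases h : t = cs.simple i
  · simp [h]
  · simp [h, Ne.symm h]

theorem zmod_two_eq_zero_or_one (a : ZMod 2) : a = 0 ∨ a = 1 := by
  revert a; decide

theorem invCocycle_self {t : W} (ht : cs.IsReflection t) :
    invCocycle cs t t = 1 := by
  obtain ⟨u, i, rfl⟩ := ht
  have h : ∀ g : W, u⁻¹ * (u * g * u⁻¹) * u = g := fun g => by group
  have h' := invCocycle_inv cs u (cs.simple i)
  rw [mul_assoc u, invCocycle_mul, ← mul_assoc u, h, invCocycle_mul, invCocycle_simple, if_pos rfl]
  simp only [cs.inv_simple, cs.simple_mul_simple_self, one_mul, h']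
  rw [add_left_comm, CharTwo.add_self_eq_zero, add_zero]

/-- The strong exchange property for (not necessarily reduced) words. -/
theorem exists_eraseIdx_of_invCocycle_ne_zero {ω : List B} {t : W}
    (h : invCocycle cs (cs.wordProd ω) t ≠ 0) :
    ∃ j < ω.length, t * cs.wordProd ω = cs.wordProd (ω.eraseIdx j) := by
  classical
  rw [invCocycle_wordProd] at h
  have hmem : t ∈ cs.leftInvSeq ω := by
    by_contra hn
    exact h (by simp [List.count_eq_zero_of_not_mem hn])
  obtain ⟨j, hj, rfl⟩ := List.mem_iff_getElem.1 hmem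
  refine ⟨j, by simpa using hj, ?_⟩
  rw [← cs.getD_leftInvSeq_mul_wordProd, List.getD_eq_getElem _ _ hj]

theorem length_mul_lt_of_invCocycle_eq_one {w t : W} (h : invCocycle cs w t = 1) :
    cs.length (t * w) < cs.length w := by
  obtain ⟨ω, hω, rfl⟩ := cs.exists_isReduced w
  obtain ⟨j, hj, e⟩ := exists_eraseIdx_of_invCocycle_ne_zero cs (h ▸ one_ne_zero)
  rw [e, hω.eq]
  refine (cs.length_wordProd_le _).trans_lt ?_
  rw [List.length_eraseIdx_of_lt hj]
  omega

theorem invCocycle_eq_one_iff {t : W} (ht : cs.IsReflection t) (w : W) :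
    invCocycle cs w t = 1 ↔ cs.length (t * w) < cs.length w := by
  refine ⟨length_mul_lt_of_invCocycle_eq_one cs, fun h => ?_⟩
  refine (zmod_two_eq_zero_or_one _).resolve_left fun h₀ => ?_
  have h₁ : invCocycle cs (t * w) t = 1 := by
    rw [invCocycle_mul, invCocycle_self cs ht, ht.inv, mul_assoc, ht.mul_self,
      mul_one, h₀, add_zero]
  have h₂ := length_mul_lt_of_invCocycle_eq_one cs h₁
  rw [← mul_assoc, ht.mul_self, one_mul] at h₂
  omega

/-! ### Parabolic subgroups -/

section Parabolic

variable {cs} {Sg : Set W}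

theorem isReflection_of_mem_simpleSet {s : W} (hs : s ∈ simpleSet cs) : cs.IsReflection s := by
  obtain ⟨i, rfl⟩ := hs
  exact cs.isReflection_simple i

theorem mem_par_of_mem {s : W} (hs : s ∈ Sg) : s ∈ par Sg := Subgroup.subset_closure hs

theorem mem_parRefl_of_mem {s : W} (hs : s ∈ Sg) : s ∈ parRefl Sg :=
  ⟨1, one_mem _, s, hs, by simp⟩

theorem parRefl_mono {Sg' : Set W} (h : Sg ⊆ Sg') : parRefl Sg ⊆ parRefl Sg' := by
  rintro _ ⟨u, hu, s, hs, rfl⟩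
  exact ⟨u, Subgroup.closure_mono h hu, s, h hs, rfl⟩

theorem conj_mem_parRefl {x t : W} (hx : x ∈ par Sg) (ht : t ∈ parRefl Sg) :
    x * t * x⁻¹ ∈ parRefl Sg := by
  obtain ⟨u, hu, s, hs, rfl⟩ := ht
  exact ⟨x * u, mul_mem hx hu, s, hs, by group⟩

theorem conj_mem_parRefl' {x t : W} (hx : x ∈ par Sg) (ht : t ∈ parRefl Sg) :
    x⁻¹ * t * x ∈ parRefl Sg := by
  simpa using conj_mem_parRefl (inv_mem hx) ht

theorem parRefl_subset_par {t : W} (ht : t ∈ parRefl Sg) : t ∈ par Sg := by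
  obtain ⟨u, hu, s, hs, rfl⟩ := ht
  exact mul_mem (mul_mem hu (mem_par_of_mem hs)) (inv_mem hu)

theorem isReflection_of_mem_parRefl (hSg : Sg ⊆ simpleSet cs) {t : W} (ht : t ∈ parRefl Sg) :
    cs.IsReflection t := by
  obtain ⟨u, -, s, hs, rfl⟩ := ht
  exact (isReflection_of_mem_simpleSet (hSg hs)).conj u

theorem mem_parRefl_of_invCocycle_ne_zero (hSg : Sg ⊆ simpleSet cs) {u : W} (hu : u ∈ par Sg) :
    ∀ {t : W}, invCocycle cs u t ≠ 0 → t ∈ parRefl Sg := by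
  induction hu using Subgroup.closure_induction with
  | mem x hx =>
    intro t h
    obtain ⟨i, rfl⟩ := hSg hx
    rw [invCocycle_simple] at h
    obtain rfl : t = cs.simple i := by
      by_contra hn
      simp [hn] at h
    exact mem_parRefl_of_mem hx
  | one => simp
  | mul x y hx _ ihx ihy =>
    intro t h
    rw [invCocycle_mul] at h
    by_cases h₁ : invCocycle cs x t = 0
    · rw [h₁, zero_add] at h
      simpa [mul_assoc] using conj_mem_parRefl hx (ihy h)
    · exact ihx h₁
  | inv x hx ih =>
    intro t h
    rw [invCocycle_inv] at h
    simpa [mul_assoc] using conj_mem_parRefl' hx (ih h)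

theorem mem_parRefl_iff (hSg : Sg ⊆ simpleSet cs) {t : W} :
    t ∈ parRefl Sg ↔ cs.IsReflection t ∧ t ∈ par Sg := by
  refine ⟨fun h => ⟨isReflection_of_mem_parRefl hSg h, parRefl_subset_par h⟩, fun h => ?_⟩
  refine mem_parRefl_of_invCocycle_ne_zero hSg h.2 ?_
  rw [invCocycle_self cs h.1]
  exact one_ne_zero

theorem exists_word_of_mem_par (hSg : Sg ⊆ simpleSet cs) {u : W} (hu : u ∈ par Sg) :
    ∃ ω : List B, (∀ i ∈ ω, cs.simple i ∈ Sg) ∧ cs.wordProd ω = u := by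
  induction hu using Subgroup.closure_induction with
  | mem x hx =>
    obtain ⟨i, rfl⟩ := hSg hx
    exact ⟨[i], by simpa using hx, by simp⟩
  | one => exact ⟨[], by simp, by simp⟩
  | mul x y _ _ ihx ihy =>
    obtain ⟨ω, h, rfl⟩ := ihx
    obtain ⟨ω', h', rfl⟩ := ihy
    refine ⟨ω ++ ω', fun i hi => ?_, cs.wordProd_append _ _⟩
    exact (List.mem_append.1 hi).elim (h i) (h' i)
  | inv x _ ih =>
    obtain ⟨ω, h, rfl⟩ := ih
    exact ⟨ω.reverse, fun i hi => h i (List.mem_reverse.1 hi), cs.wordProd_reverse _⟩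

theorem exists_invCocycle_eq_one (hSg : Sg ⊆ simpleSet cs) {u : W} (hu : u ∈ par Sg)
    (h1 : u ≠ 1) : ∃ s ∈ Sg, invCocycle cs u s = 1 := by
  classical
  have hex : ∃ n, ∃ ω : List B, ω.length = n ∧ (∀ i ∈ ω, cs.simple i ∈ Sg) ∧
      cs.wordProd ω = u := by
    obtain ⟨ω, h⟩ := exists_word_of_mem_par hSg hu
    exact ⟨_, ω, rfl, h⟩
  obtain ⟨ω, hlen, hω, hu⟩ := Nat.find_spec hex
  obtain _ | ⟨i, ω⟩ := ω
  · exact absurd hu.symm (by simpa using h1)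
  refine ⟨cs.simple i, hω i (by simp), (zmod_two_eq_zero_or_one _).resolve_left fun h => ?_⟩
  rw [← hu, cs.wordProd_cons, invCocycle_mul, invCocycle_simple, if_pos rfl, cs.inv_simple,
    cs.simple_mul_simple_self, one_mul] at h
  obtain ⟨j, hj, e⟩ := exists_eraseIdx_of_invCocycle_ne_zero cs (ω := ω) (t := cs.simple i)
    (fun h₀ => by simp [h₀] at h)
  refine Nat.find_min hex (m := (ω.eraseIdx j).length) ?_ ⟨_, rfl, fun k hk => ?_, ?_⟩
  · rw [← hlen, List.length_eraseIdx_of_lt hj, List.length_cons]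
    omega
  · exact hω k (List.mem_cons_of_mem _ (List.mem_of_mem_eraseIdx hk))
  · rw [← e, ← cs.wordProd_cons, hu]

theorem mem_of_mem_par (hSg : Sg ⊆ simpleSet cs) {s : W} (hs : s ∈ simpleSet cs)
    (h : s ∈ par Sg) : s ∈ Sg := by
  obtain ⟨i, rfl⟩ := hs
  have h1 : cs.simple i ≠ 1 := fun h => by
    have := cs.length_simple i
    simp [h] at this
  obtain ⟨s', hs', e⟩ := exists_invCocycle_eq_one hSg h h1
  rw [invCocycle_simple] at e
  by_cases hn : s' = cs.simple i
  · exact hn ▸ hs'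
  · simp [hn] at e

theorem eq_of_invCocycle_eq (hSg : Sg ⊆ simpleSet cs) {x y : W} (hx : x ∈ par Sg)
    (hy : y ∈ par Sg) (h : ∀ t ∈ parRefl Sg, invCocycle cs x t = invCocycle cs y t) : x = y := by
  by_contra hne
  obtain ⟨s, hs, e⟩ := exists_invCocycle_eq_one hSg (mul_mem (inv_mem hx) hy)
    (fun h => hne (inv_mul_eq_one.1 h))
  rw [invCocycle_mul, invCocycle_inv, inv_inv,
    h _ (conj_mem_parRefl hx (mem_parRefl_of_mem hs)), CharTwo.add_self_eq_zero] at e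
  exact zero_ne_one e

theorem eq_one_of_invCocycle_conj (hSg : Sg ⊆ simpleSet cs) {x : W} (hx : x ∈ par Sg)
    (h : ∀ s ∈ Sg, invCocycle cs x (x * s * x⁻¹) = 0) : x = 1 := by
  by_contra hne
  obtain ⟨s, hs, e⟩ := exists_invCocycle_eq_one hSg (inv_mem hx) (inv_ne_one.2 hne)
  rw [invCocycle_inv, h s hs] at e
  exact zero_ne_one e

theorem invCocycle_mul_conj (x w s : W) :
    invCocycle cs (x * w) (x * s * x⁻¹) = invCocycle cs x (x * s * x⁻¹) + invCocycle cs w s := by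
  rw [invCocycle_mul]
  congr 2
  group

theorem length_le_of_invCocycle_eq_zero (hSg : Sg ⊆ simpleSet cs) {w : W}
    (h : ∀ s ∈ Sg, invCocycle cs w s = 0) {y : W} (hy : y ∈ par Sg) :
    cs.length w ≤ cs.length (y * w) := by
  obtain ⟨x, hx, hmin⟩ : ∃ x ∈ par Sg, ∀ u ∈ par Sg, cs.length (x * w) ≤ cs.length (u * w) := by
    obtain ⟨x, hx, hmin⟩ := exists_minimalFor_of_wellFoundedLT (· ∈ par Sg)
      (fun x => cs.length (x * w)) ⟨1, one_mem _⟩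
    exact ⟨x, hx, fun u hu => (le_total _ _).elim id (hmin hu)⟩
  suffices x = 1 by simpa [this] using hmin y hy
  refine eq_one_of_invCocycle_conj hSg hx fun s hs => ?_
  have hxw := invCocycle_mul_conj (cs := cs) x w s
  rw [h s hs, add_zero] at hxw
  rw [← hxw]
  refine (zmod_two_eq_zero_or_one _).resolve_right fun e => ?_
  have := length_mul_lt_of_invCocycle_eq_one cs e
  rw [← mul_assoc] at this
  exact this.not_ge (hmin _ (mul_mem
    (parRefl_subset_par (conj_mem_parRefl hx (mem_parRefl_of_mem hs))) hx))

theorem invCocycle_eq_zero_of_simple (hSg : Sg ⊆ simpleSet cs) {w : W}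
    (h : ∀ s ∈ Sg, invCocycle cs w s = 0) {t : W} (ht : t ∈ parRefl Sg) :
    invCocycle cs w t = 0 :=
  (zmod_two_eq_zero_or_one _).resolve_right fun e =>
    (length_mul_lt_of_invCocycle_eq_one cs e).not_ge
      (length_le_of_invCocycle_eq_zero hSg h (parRefl_subset_par ht))

theorem invCocycle_eq_one_of_forall_length_le (hSg : Sg ⊆ simpleSet cs) {v : W}
    (h : ∀ u ∈ par Sg, cs.length (u * v) ≤ cs.length v) {t : W} (ht : t ∈ parRefl Sg) :
    invCocycle cs v t = 1 := by
  have hr := isReflection_of_mem_parRefl hSg ht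
  rw [invCocycle_eq_one_iff cs hr]
  exact (h t (parRefl_subset_par ht)).lt_of_ne (hr.length_mul_right_ne v)

theorem isLongest_longest (hfin : (par Sg : Set W).Finite) :
    IsLongest cs Sg (longest cs Sg) := by
  have h : ∃ w, IsLongest cs Sg w :=
    Set.exists_max_image (par Sg : Set W) cs.length hfin ⟨1, one_mem _⟩
  rw [longest, dif_pos h]
  exact h.choose_spec

theorem IsLongest.invCocycle_eq_one (hSg : Sg ⊆ simpleSet cs) {w t : W}
    (hw : IsLongest cs Sg w) (ht : t ∈ parRefl Sg) : invCocycle cs w t = 1 :=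
  invCocycle_eq_one_of_forall_length_le hSg (fun _ hu => hw.2 _ (mul_mem hu hw.1)) ht

end Parabolic

/-! ### Relative simple reflections -/

section Relative

variable {cs} {Sg : Set W}

theorem mem_relW_iff (hSg : Sg ⊆ simpleSet cs) {w : W} :
    w ∈ relW cs Sg ↔
      w ∈ Subgroup.normalizer (par Sg : Set W) ∧ ∀ t ∈ parRefl Sg, invCocycle cs w t = 0 := by
  rw [Subgroup.mem_normalizer_iff_conj_image_eq, relW, Set.mem_ofPred_eq,
    Set.eq_empty_iff_forall_notMem]
  refine and_congr Iff.rfl (forall_congr' fun t => ?_)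
  constructor
  · intro h ht
    have hr := isReflection_of_mem_parRefl hSg ht
    exact (zmod_two_eq_zero_or_one _).resolve_right fun e =>
      h ⟨⟨hr, (invCocycle_eq_one_iff cs hr w).1 e⟩, ht⟩
  · rintro h ⟨⟨hr, hlt⟩, ht⟩
    have := (invCocycle_eq_one_iff cs hr w).2 hlt
    rw [h ht] at this
    exact zero_ne_one this

theorem conj_mem_parRefl_iff_of_mem_normalizer (hSg : Sg ⊆ simpleSet cs) {w : W}
    (hw : w ∈ Subgroup.normalizer (par Sg : Set W)) (t : W) :
    w * t * w⁻¹ ∈ parRefl Sg ↔ t ∈ parRefl Sg := by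
  rw [mem_parRefl_iff hSg, mem_parRefl_iff hSg, cs.isReflection_conj_iff,
    ← Subgroup.mem_normalizer_iff.1 hw t]

theorem conj_mem_parRefl_iff_of_mem_normalizer' (hSg : Sg ⊆ simpleSet cs) {w : W}
    (hw : w ∈ Subgroup.normalizer (par Sg : Set W)) (t : W) :
    w⁻¹ * t * w ∈ parRefl Sg ↔ t ∈ parRefl Sg := by
  simpa using conj_mem_parRefl_iff_of_mem_normalizer hSg (inv_mem hw) t

theorem one_mem_relW (hSg : Sg ⊆ simpleSet cs) : (1 : W) ∈ relW cs Sg :=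
  (mem_relW_iff hSg).2 ⟨one_mem _, fun _ _ => invCocycle_one cs _⟩

theorem mul_mem_relW (hSg : Sg ⊆ simpleSet cs) {x y : W} (hx : x ∈ relW cs Sg)
    (hy : y ∈ relW cs Sg) : x * y ∈ relW cs Sg := by
  rw [mem_relW_iff hSg] at *
  refine ⟨mul_mem hx.1 hy.1, fun t ht => ?_⟩
  rw [invCocycle_mul, hx.2 t ht,
    hy.2 _ ((conj_mem_parRefl_iff_of_mem_normalizer' hSg hx.1 t).2 ht), add_zero]

theorem list_prod_mem_relW (hSg : Sg ⊆ simpleSet cs) {l : List W}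
    (hl : ∀ x ∈ l, x ∈ relW cs Sg) : l.prod ∈ relW cs Sg := by
  induction l with
  | nil => exact one_mem_relW hSg
  | cons x l ih =>
    rw [List.prod_cons]
    exact mul_mem_relW hSg (hl x (by simp)) (ih fun y hy => hl y (by simp [hy]))

theorem union_subset_simpleSet (hSg : Sg ⊆ simpleSet cs) {s : W} (hs : s ∈ complSet cs Sg) :
    Sg ∪ {s} ⊆ simpleSet cs :=
  Set.union_subset hSg (Set.singleton_subset_iff.2 hs.1.1)

theorem notMem_par_of_mem_complSet (hSg : Sg ⊆ simpleSet cs) {s : W} (hs : s ∈ complSet cs Sg) :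
    s ∉ par Sg :=
  fun h => hs.1.2 (mem_of_mem_par hSg hs.1.1 h)

theorem tilde_mem_par (hSg : GoodSubset cs Sg) {s : W} (hs : s ∈ complSet cs Sg) :
    tilde cs Sg s ∈ par (Sg ∪ {s}) :=
  mul_mem (isLongest_longest hs.2).1
    (Subgroup.closure_mono Set.subset_union_left (isLongest_longest hSg.2.1).1)

theorem longest_union_mem_normalizer (hSg : GoodSubset cs Sg) {s : W}
    (hs : s ∈ complSet cs Sg) :
    longest cs (Sg ∪ {s}) ∈ Subgroup.normalizer (par Sg : Set W) := by
  rw [Subgroup.mem_normalizer_iff_conj_image_eq]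
  exact hSg.2.2 _ Set.subset_union_left (union_subset_simpleSet hSg.1 hs) hs.2 _
    (isLongest_longest hs.2)

theorem tilde_mem_normalizer (hSg : GoodSubset cs Sg) {s : W} (hs : s ∈ complSet cs Sg) :
    tilde cs Sg s ∈ Subgroup.normalizer (par Sg : Set W) :=
  mul_mem (longest_union_mem_normalizer hSg hs)
    (Subgroup.le_normalizer (isLongest_longest hSg.2.1).1)

open Classical in
theorem invCocycle_tilde (hSg : GoodSubset cs Sg) {s : W} (hs : s ∈ complSet cs Sg) {t : W}
    (ht : t ∈ parRefl (Sg ∪ {s})) :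
    invCocycle cs (tilde cs Sg s) t = if t ∈ parRefl Sg then 0 else 1 := by
  have hconj := conj_mem_parRefl_iff_of_mem_normalizer' hSg.1
    (longest_union_mem_normalizer hSg hs) t
  have hlong := isLongest_longest (cs := cs) hSg.2.1
  rw [tilde, invCocycle_mul,
    (isLongest_longest hs.2).invCocycle_eq_one (union_subset_simpleSet hSg.1 hs) ht]
  split_ifs with h
  · rw [hlong.invCocycle_eq_one hSg.1 (hconj.2 h), CharTwo.add_self_eq_zero]
  · rw [add_eq_left]
    by_contra hne
    exact h (hconj.1 (mem_parRefl_of_invCocycle_ne_zero hSg.1 hlong.1 hne))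

theorem tilde_mem_relW (hSg : GoodSubset cs Sg) {s : W} (hs : s ∈ complSet cs Sg) :
    tilde cs Sg s ∈ relW cs Sg := by
  refine (mem_relW_iff hSg.1).2 ⟨tilde_mem_normalizer hSg hs, fun t ht => ?_⟩
  rw [invCocycle_tilde hSg hs (parRefl_mono Set.subset_union_left ht), if_pos ht]

/-- If `s` is not a left descent of `w ∈ W̃`, then no element of `Σ ∪ {s}` is. -/
theorem invCocycle_eq_zero_of_mem_relW (hSg : Sg ⊆ simpleSet cs) {w s : W}
    (hw : w ∈ relW cs Sg) (hs : s ∈ complSet cs Sg) (h : invCocycle cs w s = 0) :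
    ∀ a ∈ Sg ∪ {s}, invCocycle cs w a = 0 := by
  rintro a (ha | rfl)
  · exact ((mem_relW_iff hSg).1 hw).2 a (mem_parRefl_of_mem ha)
  · exact h

theorem inv_mem_relW (hSg : Sg ⊆ simpleSet cs) {x : W} (hx : x ∈ relW cs Sg) :
    x⁻¹ ∈ relW cs Sg := by
  rw [mem_relW_iff hSg] at *
  refine ⟨inv_mem hx.1, fun t ht => ?_⟩
  rw [invCocycle_inv, hx.2 _ ((conj_mem_parRefl_iff_of_mem_normalizer hSg hx.1 t).2 ht)]

theorem conj_mem_par_union {p r s g : W} (hp : p ∈ Subgroup.normalizer (par Sg : Set W))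
    (hrs : p * r * p⁻¹ = s) (hg : g ∈ par (Sg ∪ {r})) : p * g * p⁻¹ ∈ par (Sg ∪ {s}) := by
  suffices par (Sg ∪ {r}) ≤ (par (Sg ∪ {s})).comap (MulAut.conj p).toMonoidHom from this hg
  refine (Subgroup.closure_le _).2 ?_
  rintro a (ha | rfl)
  · exact Subgroup.closure_mono Set.subset_union_left
      ((Subgroup.mem_normalizer_iff.1 hp a).1 (mem_par_of_mem ha))
  · exact mem_par_of_mem (Or.inr hrs)

/-- If the conjugate of `s` by `p⁻¹` is a reflection of a parabolic subgroup `W_C`, and `p` is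
minimal in `p W_C`, then this conjugate is one of the generators in `C`. -/
theorem conj_mem_of_invCocycle_eq_zero {A C : Set W} (hA : A ⊆ simpleSet cs)
    (hC : C ⊆ simpleSet cs) {p s : W} (hs : s ∈ A)
    (hCp : ∀ t ∈ parRefl C, invCocycle cs p (p * t * p⁻¹) = 0)
    (ht : p⁻¹ * s * p ∈ parRefl C) : p⁻¹ * s * p ∈ C := by
  have hr := isReflection_of_mem_simpleSet (hA hs)
  have hne : p⁻¹ * s * p ≠ 1 := fun h => by
    have h1 : s = 1 := by
      have := congrArg (fun x => p * x * p⁻¹) h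
      simpa [mul_assoc] using this
    have := hr.odd_length
    simp [h1] at this
  obtain ⟨a, ha, e⟩ := exists_invCocycle_eq_one hC (parRefl_subset_par ht) hne
  have h₁ : invCocycle cs (p * (p⁻¹ * s * p)) (p * a * p⁻¹) = 1 := by
    rw [invCocycle_mul_conj, hCp a (mem_parRefl_of_mem ha), e, zero_add]
  have h₂ : s⁻¹ * (p * a * p⁻¹) * s = p * ((p⁻¹ * s * p)⁻¹ * a * (p⁻¹ * s * p)) * p⁻¹ := by group
  rw [show p * (p⁻¹ * s * p) = s * p by group, invCocycle_mul, h₂,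
    hCp _ (conj_mem_parRefl' (parRefl_subset_par ht) (mem_parRefl_of_mem ha)), add_zero] at h₁
  obtain ⟨i, rfl⟩ := hA hs
  rw [invCocycle_simple] at h₁
  have h₃ : p * a * p⁻¹ = cs.simple i := by
    by_contra hn
    simp [hn] at h₁
  rw [← h₃]
  simpa [mul_assoc] using ha

/-- If `s` is a left descent of `p r̃` but not of `p`, and `r` is not a right descent of `p`,
then `s̃ p = p r̃`. -/
theorem tilde_mul_eq_mul_tilde (hSg : GoodSubset cs Sg) {p s r : W} (hp : p ∈ relW cs Sg)
    (hs : s ∈ complSet cs Sg) (hr : r ∈ complSet cs Sg) (hps : invCocycle cs p s = 0)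
    (hprs : invCocycle cs (p * tilde cs Sg r) s = 1) (hpr : invCocycle cs p⁻¹ r = 0) :
    tilde cs Sg s * p = p * tilde cs Sg r := by
  classical
  have hA := union_subset_simpleSet hSg.1 hs
  have hC := union_subset_simpleSet hSg.1 hr
  have hpn := ((mem_relW_iff hSg.1).1 hp).1
  have hAp : ∀ t ∈ parRefl (Sg ∪ {s}), invCocycle cs p t = 0 := fun t ht =>
    invCocycle_eq_zero_of_simple hA (invCocycle_eq_zero_of_mem_relW hSg.1 hp hs hps) ht
  have hCp : ∀ t ∈ parRefl (Sg ∪ {r}), invCocycle cs p (p * t * p⁻¹) = 0 := fun t ht => by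
    rw [← invCocycle_inv]
    exact invCocycle_eq_zero_of_simple hC
      (invCocycle_eq_zero_of_mem_relW hSg.1 (inv_mem_relW hSg.1 hp) hr hpr) ht
  rw [invCocycle_mul, hps, zero_add] at hprs
  have ht : p⁻¹ * s * p ∈ parRefl (Sg ∪ {r}) :=
    mem_parRefl_of_invCocycle_ne_zero hC (tilde_mem_par hSg hr) (hprs ▸ one_ne_zero)
  have hconj : p⁻¹ * s * p = r := by
    refine (conj_mem_of_invCocycle_eq_zero hA hC (Or.inr rfl) hCp ht).resolve_left fun h => ?_
    have := (Subgroup.mem_normalizer_iff.1 hpn _).1 (mem_par_of_mem h)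
    exact notMem_par_of_mem_complSet hSg.1 hs (by simpa [mul_assoc] using this)
  have hconj' : p * r * p⁻¹ = s := by
    rw [← hconj]
    group
  have hy : p⁻¹ * tilde cs Sg s * p ∈ par (Sg ∪ {r}) := by
    simpa using conj_mem_par_union (inv_mem hpn) (by simpa using hconj) (tilde_mem_par hSg hs)
  have key : p⁻¹ * tilde cs Sg s * p = tilde cs Sg r := by
    refine eq_of_invCocycle_eq hC hy (tilde_mem_par hSg hr) fun t ht => ?_
    have ht' : p * t * p⁻¹ ∈ parRefl (Sg ∪ {s}) := by
      rw [mem_parRefl_iff hA, cs.isReflection_conj_iff]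
      exact ⟨isReflection_of_mem_parRefl hC ht,
        conj_mem_par_union hpn hconj' (parRefl_subset_par ht)⟩
    have h := invCocycle_mul_conj (cs := cs) p (p⁻¹ * tilde cs Sg s * p) t
    rw [hCp t ht, zero_add] at h
    rw [← h, show p * (p⁻¹ * tilde cs Sg s * p) = tilde cs Sg s * p by group, invCocycle_mul,
      hAp _ (conj_mem_parRefl' (tilde_mem_par hSg hs) ht'), add_zero, invCocycle_tilde hSg hs ht',
      invCocycle_tilde hSg hr ht]
    simp only [conj_mem_parRefl_iff_of_mem_normalizer hSg.1 hpn]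
  rw [← key]
  group

theorem length_list_prod_le (l : List W) : cs.length l.prod ≤ (l.map cs.length).sum := by
  induction l with
  | nil => simp
  | cons x l ih =>
    rw [List.prod_cons, List.map_cons, List.sum_cons]
    exact (cs.length_mul_le _ _).trans (by omega)

theorem length_take_prod_mul_getElem {l : List W}
    (h : cs.length l.prod = (l.map cs.length).sum) {i : ℕ} (hi : i < l.length) :
    cs.length (l.take i).prod + cs.length l[i] ≤ cs.length ((l.take i).prod * l[i]) := by
  have hsplit : l = l.take i ++ l[i] :: l.drop (i + 1) := by simp
  have h₁ := length_list_prod_le (cs := cs) (l.take i)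
  have h₂ := length_list_prod_le (cs := cs) (l.drop (i + 1))
  have hprod : l.prod = (l.take i).prod * l[i] * (l.drop (i + 1)).prod := by
    conv_lhs => rw [hsplit]
    rw [List.prod_append, List.prod_cons, mul_assoc]
  have hsum : (l.map cs.length).sum = ((l.take i).map cs.length).sum +
      (cs.length l[i] + ((l.drop (i + 1)).map cs.length).sum) := by
    conv_lhs => rw [hsplit]
    rw [List.map_append, List.sum_append, List.map_cons, List.sum_cons]
  have h₃ := cs.length_mul_le ((l.take i).prod * l[i]) (l.drop (i + 1)).prod
  rw [← hprod, h, hsum] at h₃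
  omega

theorem exists_lt_step {P : ℕ → Prop} (n : ℕ) (h0 : ¬P 0) (hn : P n) :
    ∃ i < n, ¬P i ∧ P (i + 1) := by
  induction n with
  | zero => exact absurd hn h0
  | succ n ih =>
    by_cases h : P n
    · obtain ⟨i, hi, h⟩ := ih h
      exact ⟨i, by omega, h⟩
    · exact ⟨n, by omega, h, hn⟩

end Relative

/-- relative exchange property: if `w ∈ W̃`, `s̃ ∈ S̃` with `ℓ(s̃w) < ℓ(w)`,
and `w = w₁ ⋯ w_r` with `w_i ∈ S̃` and `ℓ(w) = ℓ(w₁) + ⋯ + ℓ(w_r)`, then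
`s̃ w₁ ⋯ w_{i−1} = w₁ ⋯ w_i` for some `i`. -/
theorem relative_exchange (Sg : Set W) (hSg : GoodSubset cs Sg)
    (w s : W) (hw : w ∈ relW cs Sg) (hs : s ∈ relS cs Sg)
    (hlen : cs.length (s * w) < cs.length w)
    (l : List W) (hl : ∀ x ∈ l, x ∈ relS cs Sg) (hprod : l.prod = w)
    (hadd : cs.length w = (l.map cs.length).sum) :
    ∃ i < l.length, s * (l.take i).prod = (l.take (i + 1)).prod := by
  obtain ⟨s, hsc, rfl⟩ := hs
  have hws : invCocycle cs w s = 1 := by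
    refine (zmod_two_eq_zero_or_one _).resolve_left fun h => hlen.not_ge ?_
    exact length_le_of_invCocycle_eq_zero (union_subset_simpleSet hSg.1 hsc)
      (invCocycle_eq_zero_of_mem_relW hSg.1 hw hsc h) (tilde_mem_par hSg hsc)
  obtain ⟨i, hi, h₀, h₁⟩ := exists_lt_step (P := fun i => invCocycle cs (l.take i).prod s = 1)
    l.length (by simp) (by simpa [hprod] using hws)
  refine ⟨i, hi, ?_⟩
  obtain ⟨r, hr, hir⟩ := hl _ (List.getElem_mem hi)
  have hp : (l.take i).prod ∈ relW cs Sg := list_prod_mem_relW hSg.1 fun x hx => by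
    obtain ⟨a, ha, rfl⟩ := hl x (List.mem_of_mem_take hx)
    exact tilde_mem_relW hSg ha
  rw [← hprod] at hadd
  have hle := length_take_prod_mul_getElem hadd hi
  rw [List.prod_take_succ _ _ hi, hir] at h₁ ⊢
  rw [hir] at hle
  refine tilde_mul_eq_mul_tilde hSg hp hsc hr ((zmod_two_eq_zero_or_one _).resolve_right h₀) h₁
    ((zmod_two_eq_zero_or_one _).resolve_right fun h => ?_)
  have hrefl := isReflection_of_mem_simpleSet hr.1.1
  have h₂ := length_mul_lt_of_invCocycle_eq_one cs h
  rw [← cs.length_inv, mul_inv_rev, inv_inv, hrefl.inv, cs.length_inv] at h₂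
  have h₃ : invCocycle cs (tilde cs Sg r) r = 1 := by
    classical
    rw [invCocycle_tilde hSg hr (mem_parRefl_of_mem (Or.inr rfl)),
      if_neg fun h => notMem_par_of_mem_complSet hSg.1 hr (parRefl_subset_par h)]
  have h₄ := length_mul_lt_of_invCocycle_eq_one cs h₃
  have h₅ := cs.length_mul_le ((l.take i).prod * r) (r * tilde cs Sg r)
  rw [mul_assoc, ← mul_assoc r, hrefl.mul_self, one_mul] at h₅
  omega

end RelativeCoxeter
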